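/- Let k be a field of characteristic zero, (A, ϑ, θ) a pre-Poisson coalgebra and (B, ν) a perm coalgebra over k. Define Δ(a ⊗ b) = (id ⊗ id + τ)(ϑ(a) • ν(b)) and δ(a ⊗ b) = (id ⊗ id − τ)(θ(a) • ν(b)). Then (A ⊗ B, Δ, δ) is a Poisson coalgebra. -/

import Mathlib

open TensorProduct

noncomputable section

def IsZinbiel {k A : Type} [Field k] [AddCommGroup A] [Module k A]
    (ast : A →ₗ[k] A →ₗ[k] A) : Prop :=
  ∀ a₁ a₂ a₃ : A, ast a₁ (ast a₂ a₃) = ast (ast a₁ a₂) a₃ + ast (ast a₂ a₁) a₃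

def IsPreLie {k A : Type} [Field k] [AddCommGroup A] [Module k A]
    (circ : A →ₗ[k] A →ₗ[k] A) : Prop :=
  ∀ a₁ a₂ a₃ : A,
    circ (circ a₁ a₂) a₃ - circ a₁ (circ a₂ a₃)
      = circ (circ a₂ a₁) a₃ - circ a₂ (circ a₁ a₃)

def IsPerm {k B : Type} [Field k] [AddCommGroup B] [Module k B]
    (dia : B →ₗ[k] B →ₗ[k] B) : Prop :=
  ∀ b₁ b₂ b₃ : B,
    dia b₁ (dia b₂ b₃) = dia (dia b₁ b₂) b₃ ∧
    dia (dia b₁ b₂) b₃ = dia (dia b₂ b₁) b₃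

def IsPrePoisson {k A : Type} [Field k] [AddCommGroup A] [Module k A]
    (ast circ : A →ₗ[k] A →ₗ[k] A) : Prop :=
  IsZinbiel ast ∧ IsPreLie circ ∧
  (∀ a₁ a₂ a₃ : A,
    ast (circ a₁ a₂ - circ a₂ a₁) a₃ = circ a₁ (ast a₂ a₃) - ast a₂ (circ a₁ a₃)) ∧
  (∀ a₁ a₂ a₃ : A,
    circ (ast a₁ a₂ + ast a₂ a₁) a₃ = ast a₁ (circ a₂ a₃) + ast a₂ (circ a₁ a₃))

def IsPoisson {k P : Type} [Field k] [AddCommGroup P] [Module k P]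
    (mul br : P →ₗ[k] P →ₗ[k] P) : Prop :=
  (∀ u v : P, mul u v = mul v u) ∧
  (∀ u v w : P, mul (mul u v) w = mul u (mul v w)) ∧
  (∀ u v : P, br u v = - br v u) ∧
  (∀ u v w : P, br (br u v) w + br (br v w) u + br (br w u) v = 0) ∧
  (∀ u v w : P, br u (mul v w) = mul (br u v) w + mul v (br u w))

def idm (k M : Type) [Field k] [AddCommGroup M] [Module k M] : M →ₗ[k] M :=
  LinearMap.id

def tau (k M : Type) [Field k] [AddCommGroup M] [Module k M] :
    M ⊗[k] M →ₗ[k] M ⊗[k] M :=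
  (TensorProduct.comm k M M).toLinearMap

def unassoc (k M : Type) [Field k] [AddCommGroup M] [Module k M] :
    M ⊗[k] (M ⊗[k] M) →ₗ[k] (M ⊗[k] M) ⊗[k] M :=
  (TensorProduct.assoc k M M M).symm.toLinearMap

def intch (k A B : Type) [Field k] [AddCommGroup A] [Module k A]
    [AddCommGroup B] [Module k B] :
    (A ⊗[k] A) ⊗[k] (B ⊗[k] B) →ₗ[k] (A ⊗[k] B) ⊗[k] (A ⊗[k] B) :=
  (TensorProduct.tensorTensorTensorComm k A A B B).toLinearMap

def IsZinbielCo {k A : Type} [Field k] [AddCommGroup A] [Module k A]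
    (ϑ : A →ₗ[k] A ⊗[k] A) : Prop :=
  ∀ a : A,
    TensorProduct.map ϑ (idm k A) (ϑ a)
      + TensorProduct.map (tau k A) (idm k A) (TensorProduct.map ϑ (idm k A) (ϑ a))
    = unassoc k A (TensorProduct.map (idm k A) ϑ (ϑ a))

def IsPermCo {k B : Type} [Field k] [AddCommGroup B] [Module k B]
    (ν : B →ₗ[k] B ⊗[k] B) : Prop :=
  ∀ b : B,
    TensorProduct.map ν (idm k B) (ν b)
      = unassoc k B (TensorProduct.map (idm k B) ν (ν b)) ∧
    TensorProduct.map ν (idm k B) (ν b)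
      = TensorProduct.map (tau k B) (idm k B) (TensorProduct.map ν (idm k B) (ν b))

def IsPreLieCo {k A : Type} [Field k] [AddCommGroup A] [Module k A]
    (θ : A →ₗ[k] A ⊗[k] A) : Prop :=
  ∀ a : A,
    unassoc k A (TensorProduct.map (idm k A) θ (θ a))
      - TensorProduct.map (tau k A) (idm k A)
          (unassoc k A (TensorProduct.map (idm k A) θ (θ a)))
    = TensorProduct.map θ (idm k A) (θ a)
      - TensorProduct.map (tau k A) (idm k A) (TensorProduct.map θ (idm k A) (θ a))

def Zexp {k A : Type} [Field k] [AddCommGroup A] [Module k A]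
    (ast : A →ₗ[k] A →ₗ[k] A) {p : ℕ} (x y : Fin p → A) : (A ⊗[k] A) ⊗[k] A :=
  ∑ i : Fin p, ∑ j : Fin p,
    (((ast (x i) (x j)) ⊗ₜ[k] (y j)) ⊗ₜ[k] (y i)
      + ((y j) ⊗ₜ[k] (ast (x i) (x j))) ⊗ₜ[k] (y i)
      + ((x i) ⊗ₜ[k] (x j)) ⊗ₜ[k] (ast (y i) (y j))
      + ((x j) ⊗ₜ[k] (x i)) ⊗ₜ[k] (ast (y i) (y j))
      - ((x i) ⊗ₜ[k] (ast (y i) (x j))) ⊗ₜ[k] (y j)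
      - ((x j) ⊗ₜ[k] (ast (x i) (y j))) ⊗ₜ[k] (y i)
      - ((ast (x i) (y j)) ⊗ₜ[k] (x j)) ⊗ₜ[k] (y i)
      - ((ast (y i) (x j)) ⊗ₜ[k] (x i)) ⊗ₜ[k] (y j))

def PLexp {k A : Type} [Field k] [AddCommGroup A] [Module k A]
    (circ : A →ₗ[k] A →ₗ[k] A) {p : ℕ} (x y : Fin p → A) : (A ⊗[k] A) ⊗[k] A :=
  ∑ i : Fin p, ∑ j : Fin p,
    (((circ (x i) (x j)) ⊗ₜ[k] (y j)) ⊗ₜ[k] (y i)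
      + ((x j) ⊗ₜ[k] (circ (x i) (y j))) ⊗ₜ[k] (y i)
      + ((circ (y i) (x j)) ⊗ₜ[k] (x i)) ⊗ₜ[k] (y j)
      + ((x j) ⊗ₜ[k] (x i)) ⊗ₜ[k] (circ (y i) (y j))
      - ((y j) ⊗ₜ[k] (circ (x i) (x j))) ⊗ₜ[k] (y i)
      - ((x i) ⊗ₜ[k] (circ (y i) (x j))) ⊗ₜ[k] (y j)
      - ((circ (x i) (y j)) ⊗ₜ[k] (x j)) ⊗ₜ[k] (y i)
      - ((x i) ⊗ₜ[k] (x j)) ⊗ₜ[k] (circ (y i) (y j)))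

def AYexp {k P : Type} [Field k] [AddCommGroup P] [Module k P]
    (m : P →ₗ[k] P →ₗ[k] P) {ι : Type} [Fintype ι] (u v : ι → P) :
    (P ⊗[k] P) ⊗[k] P :=
  ∑ α : ι, ∑ β : ι,
    (((m (u α) (u β)) ⊗ₜ[k] (v α)) ⊗ₜ[k] (v β)
      + ((u α) ⊗ₜ[k] (m (v α) (u β))) ⊗ₜ[k] (v β)
      - ((u β) ⊗ₜ[k] (u α)) ⊗ₜ[k] (m (v α) (v β)))

def CYexp {k P : Type} [Field k] [AddCommGroup P] [Module k P]
    (br : P →ₗ[k] P →ₗ[k] P) {ι : Type} [Fintype ι] (u v : ι → P) :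
    (P ⊗[k] P) ⊗[k] P :=
  ∑ α : ι, ∑ β : ι,
    (((br (u α) (u β)) ⊗ₜ[k] (v α)) ⊗ₜ[k] (v β)
      + ((u α) ⊗ₜ[k] (u β)) ⊗ₜ[k] (br (v α) (v β))
      + ((u α) ⊗ₜ[k] (br (v α) (u β))) ⊗ₜ[k] (v β))

def sharp (k : Type) [Field k] {V : Type} [AddCommGroup V] [Module k V]
    (s : V ⊗[k] V) (ξ : V →ₗ[k] k) : V :=
  TensorProduct.lid k V (LinearMap.rTensor V ξ s)

abbrev PermB (k : Type) [Field k] : Type := ((ℤ × ℤ) × Fin 2) →₀ k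

def bB (k : Type) [Field k] (i₁ i₂ : ℤ) (s : Fin 2) : PermB k :=
  Finsupp.single ((i₁, i₂), s) 1

section ThreefoldTensor

variable (k M A B : Type) [Field k] [AddCommGroup M] [Module k M] [AddCommGroup A] [Module k A]
  [AddCommGroup B] [Module k B]

/-- Swap of the first two factors of a threefold tensor power. -/
def swapLeft : (M ⊗[k] M) ⊗[k] M →ₗ[k] (M ⊗[k] M) ⊗[k] M :=
  TensorProduct.map (tau k M) (idm k M)

/-- Swap of the last two factors of a threefold tensor power. -/
def swapRight : (M ⊗[k] M) ⊗[k] M →ₗ[k] (M ⊗[k] M) ⊗[k] M :=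
  unassoc k M ∘ₗ TensorProduct.map (idm k M) (tau k M) ∘ₗ
    (TensorProduct.assoc k M M M).toLinearMap

/-- The interchange of factors on threefold tensor powers. -/
def intch₃ : ((A ⊗[k] A) ⊗[k] A) ⊗[k] ((B ⊗[k] B) ⊗[k] B) →ₗ[k]
    ((A ⊗[k] B) ⊗[k] (A ⊗[k] B)) ⊗[k] (A ⊗[k] B) :=
  TensorProduct.map (intch k A B) LinearMap.id ∘ₗ
    (TensorProduct.tensorTensorTensorComm k (A ⊗[k] A) A (B ⊗[k] B) B).toLinearMap

@[simp]
theorem idm_apply (x : M) : idm k M x = x := rfl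

@[simp]
theorem tau_tmul (x y : M) : tau k M (x ⊗ₜ y) = y ⊗ₜ x := rfl

@[simp]
theorem unassoc_tmul (x y z : M) : unassoc k M (x ⊗ₜ (y ⊗ₜ z)) = (x ⊗ₜ y) ⊗ₜ z := rfl

@[simp]
theorem intch_tmul (x y : A) (u v : B) :
    intch k A B ((x ⊗ₜ y) ⊗ₜ (u ⊗ₜ v)) = (x ⊗ₜ u) ⊗ₜ (y ⊗ₜ v) := rfl

@[simp]
theorem intch₃_tmul (x y z : A) (u v w : B) :
    intch₃ k A B (((x ⊗ₜ y) ⊗ₜ z) ⊗ₜ ((u ⊗ₜ v) ⊗ₜ w))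
      = ((x ⊗ₜ u) ⊗ₜ (y ⊗ₜ v)) ⊗ₜ (z ⊗ₜ w) := rfl

@[simp]
theorem swapLeft_tmul (x y z : M) :
    swapLeft k M ((x ⊗ₜ y) ⊗ₜ z) = (y ⊗ₜ x) ⊗ₜ z := rfl

@[simp]
theorem swapRight_tmul (x y z : M) :
    swapRight k M ((x ⊗ₜ y) ⊗ₜ z) = (x ⊗ₜ z) ⊗ₜ y := rfl

variable {k M A B}

theorem tau_tau (x : M ⊗[k] M) : tau k M (tau k M x) = x := by
  have h : tau k M ∘ₗ tau k M = LinearMap.id := by ext; simp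
  exact LinearMap.congr_fun h x

theorem swapLeft_swapLeft (x : (M ⊗[k] M) ⊗[k] M) : swapLeft k M (swapLeft k M x) = x := by
  have h : swapLeft k M ∘ₗ swapLeft k M = LinearMap.id := by ext; simp
  exact LinearMap.congr_fun h x

theorem swapRight_swapRight (x : (M ⊗[k] M) ⊗[k] M) :
    swapRight k M (swapRight k M x) = x := by
  have h : swapRight k M ∘ₗ swapRight k M = LinearMap.id := by ext; simp
  exact LinearMap.congr_fun h x

theorem swapRight_swapLeft_swapRight (x : (M ⊗[k] M) ⊗[k] M) :
    swapRight k M (swapLeft k M (swapRight k M x))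
      = swapLeft k M (swapRight k M (swapLeft k M x)) := by
  have h : swapRight k M ∘ₗ swapLeft k M ∘ₗ swapRight k M
      = swapLeft k M ∘ₗ swapRight k M ∘ₗ swapLeft k M := by ext; simp
  exact LinearMap.congr_fun h x

theorem swapLeft_intch₃ (X : (A ⊗[k] A) ⊗[k] A) (Y : (B ⊗[k] B) ⊗[k] B) :
    swapLeft k (A ⊗[k] B) (intch₃ k A B (X ⊗ₜ Y))
      = intch₃ k A B (swapLeft k A X ⊗ₜ swapLeft k B Y) := by
  have h : swapLeft k (A ⊗[k] B) ∘ₗ intch₃ k A B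
      = intch₃ k A B ∘ₗ TensorProduct.map (swapLeft k A) (swapLeft k B) := by ext; simp
  exact LinearMap.congr_fun h (X ⊗ₜ Y)

theorem swapRight_intch₃ (X : (A ⊗[k] A) ⊗[k] A) (Y : (B ⊗[k] B) ⊗[k] B) :
    swapRight k (A ⊗[k] B) (intch₃ k A B (X ⊗ₜ Y))
      = intch₃ k A B (swapRight k A X ⊗ₜ swapRight k B Y) := by
  have h : swapRight k (A ⊗[k] B) ∘ₗ intch₃ k A B
      = intch₃ k A B ∘ₗ TensorProduct.map (swapRight k A) (swapRight k B) := by ext; simp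
  exact LinearMap.congr_fun h (X ⊗ₜ Y)

theorem map_tau_comp_idm (h : M →ₗ[k] M ⊗[k] M) (z : M ⊗[k] M) :
    TensorProduct.map (tau k M ∘ₗ h) (idm k M) z
      = swapLeft k M (TensorProduct.map h (idm k M) z) := by
  have e : TensorProduct.map (tau k M ∘ₗ h) (idm k M)
      = swapLeft k M ∘ₗ TensorProduct.map h (idm k M) := by
    ext; simp [swapLeft]
  exact LinearMap.congr_fun e z

theorem unassoc_map_idm_tau_comp (h : M →ₗ[k] M ⊗[k] M) (z : M ⊗[k] M) :
    unassoc k M (TensorProduct.map (idm k M) (tau k M ∘ₗ h) z)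
      = swapRight k M (unassoc k M (TensorProduct.map (idm k M) h z)) := by
  have e : TensorProduct.map (idm k M) (tau k M ∘ₗ h)
      = TensorProduct.map (idm k M) (tau k M) ∘ₗ TensorProduct.map (idm k M) h := by
    ext; simp
  simp [e, swapRight, unassoc]

theorem map_idm_tau (h : M →ₗ[k] M ⊗[k] M) (z : M ⊗[k] M) :
    TensorProduct.map h (idm k M) (tau k M z)
      = swapRight k M (swapLeft k M (unassoc k M (TensorProduct.map (idm k M) h z))) := by
  induction z using TensorProduct.induction_on with
  | zero => simp
  | add x y hx hy => simp only [map_add, hx, hy]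
  | tmul x y =>
    simp only [tau_tmul, TensorProduct.map_tmul, idm_apply]
    induction h y using TensorProduct.induction_on with
    | zero => simp
    | add u v hu hv => simp only [TensorProduct.add_tmul, TensorProduct.tmul_add, map_add, hu, hv]
    | tmul u v => simp

theorem unassoc_map_idm_tau (h : M →ₗ[k] M ⊗[k] M) (z : M ⊗[k] M) :
    unassoc k M (TensorProduct.map (idm k M) h (tau k M z))
      = swapLeft k M (swapRight k M (TensorProduct.map h (idm k M) z)) := by
  rw [← tau_tau z, map_idm_tau, tau_tau, swapRight_swapRight, swapLeft_swapLeft]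

end ThreefoldTensor

section InducedCooperation

variable {k A B : Type} [Field k] [AddCommGroup A] [Module k A] [AddCommGroup B] [Module k B]

/-- The cooperation `a ⊗ b ↦ f a • ν b` on `A ⊗ B`. -/
def interchangeCo (f : A →ₗ[k] A ⊗[k] A) (ν : B →ₗ[k] B ⊗[k] B) :
    A ⊗[k] B →ₗ[k] (A ⊗[k] B) ⊗[k] (A ⊗[k] B) :=
  intch k A B ∘ₗ TensorProduct.map f ν

/-- The cooperation `a ⊗ b ↦ (id + ε τ) (f a • ν b)` on `A ⊗ B`. -/
def twistedCo (ε : k) (f : A →ₗ[k] A ⊗[k] A) (ν : B →ₗ[k] B ⊗[k] B) :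
    A ⊗[k] B →ₗ[k] (A ⊗[k] B) ⊗[k] (A ⊗[k] B) :=
  interchangeCo f ν + ε • (tau k (A ⊗[k] B) ∘ₗ interchangeCo f ν)

theorem map_interchangeCo_idm_intch (g : A →ₗ[k] A ⊗[k] A) (ν : B →ₗ[k] B ⊗[k] B)
    (x : A ⊗[k] A) (y : B ⊗[k] B) :
    TensorProduct.map (interchangeCo g ν) (idm k _) (intch k A B (x ⊗ₜ y))
      = intch₃ k A B (TensorProduct.map g (idm k A) x ⊗ₜ TensorProduct.map ν (idm k B) y) := by
  have h : TensorProduct.map (interchangeCo g ν) (idm k _) ∘ₗ intch k A B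
      = intch₃ k A B ∘ₗ TensorProduct.map (TensorProduct.map g (idm k A))
        (TensorProduct.map ν (idm k B)) := by
    ext
    simp [interchangeCo, intch₃]
  exact LinearMap.congr_fun h (x ⊗ₜ y)

theorem unassoc_map_idm_interchangeCo_intch (g : A →ₗ[k] A ⊗[k] A) (ν : B →ₗ[k] B ⊗[k] B)
    (x : A ⊗[k] A) (y : B ⊗[k] B) :
    unassoc k _ (TensorProduct.map (idm k _) (interchangeCo g ν) (intch k A B (x ⊗ₜ y)))
      = intch₃ k A B (unassoc k A (TensorProduct.map (idm k A) g x)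
        ⊗ₜ unassoc k B (TensorProduct.map (idm k B) ν y)) := by
  have h : intch k A B (x ⊗ₜ y) = tau k _ (intch k A B (tau k A x ⊗ₜ tau k B y)) := by
    have e : intch k A B = tau k _ ∘ₗ intch k A B ∘ₗ TensorProduct.map (tau k A) (tau k B) := by
      ext; simp
    exact LinearMap.congr_fun e (x ⊗ₜ y)
  rw [h, unassoc_map_idm_tau, map_interchangeCo_idm_intch, swapRight_intch₃, swapLeft_intch₃,
    ← unassoc_map_idm_tau, ← unassoc_map_idm_tau, tau_tau, tau_tau]

theorem tau_twistedCo {ε : k} (hε : ε * ε = 1) (f : A →ₗ[k] A ⊗[k] A) (ν : B →ₗ[k] B ⊗[k] B)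
    (q : A ⊗[k] B) :
    tau k (A ⊗[k] B) (twistedCo ε f ν q) = ε • twistedCo ε f ν q := by
  simp only [twistedCo, LinearMap.add_apply, LinearMap.smul_apply, LinearMap.comp_apply, map_add,
    map_smul, tau_tau, smul_add, smul_smul, hε, one_smul]
  abel

theorem map_twistedCo_idm_twistedCo {ν : B →ₗ[k] B ⊗[k] B} (hν : IsPermCo ν) (ε η : k)
    (f g : A →ₗ[k] A ⊗[k] A) (a : A) (b : B) :
    TensorProduct.map (twistedCo η g ν) (idm k _) (twistedCo ε f ν (a ⊗ₜ b))
      = intch₃ k A B (TensorProduct.map g (idm k A) (f a) ⊗ₜ TensorProduct.map ν (idm k B) (ν b))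
        + η • intch₃ k A B (swapLeft k A (TensorProduct.map g (idm k A) (f a))
          ⊗ₜ TensorProduct.map ν (idm k B) (ν b))
        + ε • intch₃ k A B
          (swapRight k A (swapLeft k A (unassoc k A (TensorProduct.map (idm k A) g (f a))))
            ⊗ₜ swapRight k B (TensorProduct.map ν (idm k B) (ν b)))
        + (ε * η) • intch₃ k A B
          (swapLeft k A (swapRight k A (swapLeft k A
              (unassoc k A (TensorProduct.map (idm k A) g (f a)))))
            ⊗ₜ swapLeft k B (swapRight k B (TensorProduct.map ν (idm k B) (ν b)))) := by
  have h₁ : unassoc k B (TensorProduct.map (idm k B) ν (ν b))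
      = TensorProduct.map ν (idm k B) (ν b) := (hν b).1.symm
  have h₂ : swapLeft k B (TensorProduct.map ν (idm k B) (ν b))
      = TensorProduct.map ν (idm k B) (ν b) := (hν b).2.symm
  have hD : interchangeCo f ν (a ⊗ₜ b) = intch k A B (f a ⊗ₜ ν b) := rfl
  simp only [twistedCo, TensorProduct.map_add_left, TensorProduct.map_smul_left,
    LinearMap.add_apply, LinearMap.smul_apply, LinearMap.comp_apply, map_add, map_smul,
    map_tau_comp_idm, map_idm_tau, unassoc_map_idm_tau_comp, swapRight_swapLeft_swapRight,
    hD, map_interchangeCo_idm_intch,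
    unassoc_map_idm_interchangeCo_intch, swapLeft_intch₃, swapRight_intch₃, h₁, h₂]
  module

theorem unassoc_map_idm_twistedCo_twistedCo {ν : B →ₗ[k] B ⊗[k] B} (hν : IsPermCo ν) (ε η : k)
    (f g : A →ₗ[k] A ⊗[k] A) (a : A) (b : B) :
    unassoc k _ (TensorProduct.map (idm k _) (twistedCo η g ν) (twistedCo ε f ν (a ⊗ₜ b)))
      = intch₃ k A B (unassoc k A (TensorProduct.map (idm k A) g (f a))
          ⊗ₜ TensorProduct.map ν (idm k B) (ν b))
        + η • intch₃ k A B (swapRight k A (unassoc k A (TensorProduct.map (idm k A) g (f a)))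
          ⊗ₜ swapRight k B (TensorProduct.map ν (idm k B) (ν b)))
        + ε • intch₃ k A B
          (swapLeft k A (swapRight k A (TensorProduct.map g (idm k A) (f a)))
            ⊗ₜ swapLeft k B (swapRight k B (TensorProduct.map ν (idm k B) (ν b))))
        + (ε * η) • intch₃ k A B
          (swapLeft k A (swapRight k A (swapLeft k A (TensorProduct.map g (idm k A) (f a))))
            ⊗ₜ swapLeft k B (swapRight k B (TensorProduct.map ν (idm k B) (ν b)))) := by
  have h₁ : unassoc k B (TensorProduct.map (idm k B) ν (ν b))
      = TensorProduct.map ν (idm k B) (ν b) := (hν b).1.symm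
  have h₂ : swapLeft k B (TensorProduct.map ν (idm k B) (ν b))
      = TensorProduct.map ν (idm k B) (ν b) := (hν b).2.symm
  have hD : interchangeCo f ν (a ⊗ₜ b) = intch k A B (f a ⊗ₜ ν b) := rfl
  simp only [twistedCo, TensorProduct.map_add_right, TensorProduct.map_smul_right,
    LinearMap.add_apply, LinearMap.smul_apply, LinearMap.comp_apply, map_add, map_smul,
    unassoc_map_idm_tau_comp, unassoc_map_idm_tau, map_tau_comp_idm, hD,
    map_interchangeCo_idm_intch, unassoc_map_idm_interchangeCo_intch, swapLeft_intch₃,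
    swapRight_intch₃, h₁, h₂]
  module

end InducedCooperation

section LinearCombination

variable {k V : Type} [Field k] [AddCommGroup V] [Module k V]

theorem coLie_combination {r₁ r₂ r₃ s₁ s₂ s₃ l₁ l₂ l₃ m₁ m₂ m₃ : V}
    (h₁ : r₁ - s₁ = l₁ - m₁) (h₂ : r₂ - s₂ = l₂ - m₂) (h₃ : r₃ - s₃ = l₃ - m₃) :
    r₁ + (-1 : k) • r₂ + (-1 : k) • l₃ + ((-1 : k) * -1) • m₃
        - (s₁ + (-1 : k) • r₃ + (-1 : k) • l₂ + ((-1 : k) * -1) • m₂)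
      = l₁ + (-1 : k) • m₁ + (-1 : k) • s₂ + ((-1 : k) * -1) • s₃ := by
  rw [sub_eq_iff_eq_add] at h₁ h₂ h₃
  rw [h₁, h₂, h₃]
  module

theorem coLeibniz_combination {r₁ r₂ s₁ s₂ s₃ t₃ l₁ l₂ l₃ m₁ m₂ m₃ : V}
    (h₁ : l₁ - m₁ = r₁ - s₁) (h₂ : l₂ - m₂ = r₂ - s₂) (h₃ : l₃ + m₃ = s₃ + t₃) :
    r₁ + (1 : k) • r₂ + (-1 : k) • l₃ + ((-1 : k) * 1) • m₃
      = l₁ + (-1 : k) • m₁ + (1 : k) • s₂ + ((1 : k) * -1) • t₃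
        + (s₁ + (-1 : k) • s₃ + (1 : k) • l₂ + ((1 : k) * -1) • m₂) := by
  rw [sub_eq_iff_eq_add] at h₁ h₂
  rw [← eq_sub_iff_add_eq] at h₃
  rw [h₁, h₂, h₃]
  module

end LinearCombination

theorem statement5 (k A B : Type) [Field k] [CharZero k]
    [AddCommGroup A] [Module k A] [AddCommGroup B] [Module k B]
    (ϑ θ : A →ₗ[k] A ⊗[k] A) (hϑ : IsZinbielCo ϑ) (hθ : IsPreLieCo θ)
    (hPPco1 : ∀ a : A,
      TensorProduct.map (θ - (tau k A) ∘ₗ θ) (idm k A) (ϑ a)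
        = unassoc k A (TensorProduct.map (idm k A) ϑ (θ a))
          - TensorProduct.map (tau k A) (idm k A)
              (unassoc k A (TensorProduct.map (idm k A) θ (ϑ a))))
    (hPPco2 : ∀ a : A,
      TensorProduct.map (ϑ + (tau k A) ∘ₗ ϑ) (idm k A) (θ a)
        = unassoc k A (TensorProduct.map (idm k A) θ (ϑ a))
          + TensorProduct.map (tau k A) (idm k A)
              (unassoc k A (TensorProduct.map (idm k A) θ (ϑ a))))
    (ν : B →ₗ[k] B ⊗[k] B) (hνp : IsPermCo ν)
    (Δ : A ⊗[k] B →ₗ[k] (A ⊗[k] B) ⊗[k] (A ⊗[k] B))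
    (hΔ : ∀ (a : A) (b : B),
      Δ (a ⊗ₜ[k] b)
        = intch k A (B) ((ϑ a) ⊗ₜ[k] (ν b))
          + tau k (A ⊗[k] B) (intch k A (B) ((ϑ a) ⊗ₜ[k] (ν b))))
    (δ : A ⊗[k] B →ₗ[k] (A ⊗[k] B) ⊗[k] (A ⊗[k] B))
    (hδ : ∀ (a : A) (b : B),
      δ (a ⊗ₜ[k] b)
        = intch k A (B) ((θ a) ⊗ₜ[k] (ν b))
          - tau k (A ⊗[k] B) (intch k A (B) ((θ a) ⊗ₜ[k] (ν b))))
    :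
    (∀ q : A ⊗[k] B, tau k (A ⊗[k] B) (Δ q) = Δ q) ∧
    (∀ q : A ⊗[k] B,
      TensorProduct.map Δ (idm k (A ⊗[k] B)) (Δ q)
        = unassoc k (A ⊗[k] B) (TensorProduct.map (idm k (A ⊗[k] B)) Δ (Δ q))) ∧
    (∀ q : A ⊗[k] B, tau k (A ⊗[k] B) (δ q) = - δ q) ∧
    (∀ q : A ⊗[k] B,
      unassoc k (A ⊗[k] B) (TensorProduct.map (idm k (A ⊗[k] B)) δ (δ q))
        - TensorProduct.map (tau k (A ⊗[k] B)) (idm k (A ⊗[k] B))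
            (unassoc k (A ⊗[k] B) (TensorProduct.map (idm k (A ⊗[k] B)) δ (δ q)))
        = TensorProduct.map δ (idm k (A ⊗[k] B)) (δ q)) ∧
    (∀ q : A ⊗[k] B,
      unassoc k (A ⊗[k] B) (TensorProduct.map (idm k (A ⊗[k] B)) Δ (δ q))
        = TensorProduct.map δ (idm k (A ⊗[k] B)) (Δ q)
          + TensorProduct.map (tau k (A ⊗[k] B)) (idm k (A ⊗[k] B))
              (unassoc k (A ⊗[k] B) (TensorProduct.map (idm k (A ⊗[k] B)) δ (Δ q)))) := by
  obtain rfl : Δ = twistedCo 1 ϑ ν :=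
    TensorProduct.ext' fun a b => by simp [hΔ, twistedCo, interchangeCo]
  obtain rfl : δ = twistedCo (-1) θ ν :=
    TensorProduct.ext' fun a b => by simp [hδ, twistedCo, interchangeCo, sub_eq_add_neg]
  have map_sub_left (f g : A →ₗ[k] A ⊗[k] A) : TensorProduct.map (f - g) (idm k A)
      = TensorProduct.map f (idm k A) - TensorProduct.map g (idm k A) := by
    ext; simp [TensorProduct.sub_tmul]
  have swapLeft_def (M : Type) [AddCommGroup M] [Module k M] :
      TensorProduct.map (tau k M) (idm k M) = swapLeft k M := rfl
  simp only [IsZinbielCo, IsPreLieCo, swapLeft_def, TensorProduct.map_add_left,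
    map_sub_left, LinearMap.add_apply, LinearMap.sub_apply, map_tau_comp_idm]
    at hϑ hθ hPPco1 hPPco2 ⊢
  refine ⟨fun q => ?_, fun q => ?_, fun q => ?_, fun q => ?_, fun q => ?_⟩
  · rw [tau_twistedCo (by norm_num), one_smul]
  · induction q using TensorProduct.induction_on with
    | zero => simp
    | add x y hx hy => simp only [map_add, hx, hy]
    | tmul a b =>
      rw [map_twistedCo_idm_twistedCo hνp, unassoc_map_idm_twistedCo_twistedCo hνp, ← hϑ]
      simp only [map_add, TensorProduct.add_tmul, swapLeft_swapLeft]
      module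
  · rw [tau_twistedCo (by norm_num)]
    module
  · induction q using TensorProduct.induction_on with
    | zero => simp
    | add x y hx hy =>
      simp only [map_add, ← hx, ← hy]
      abel
    | tmul a b =>
      rw [map_twistedCo_idm_twistedCo hνp, unassoc_map_idm_twistedCo_twistedCo hνp]
      have hN : swapLeft k B (TensorProduct.map ν (idm k B) (ν b))
          = TensorProduct.map ν (idm k B) (ν b) := (hνp b).2.symm
      set N := TensorProduct.map ν (idm k B) (ν b)
      have h₁ := congrArg (fun X => intch₃ k A B (X ⊗ₜ N)) (hθ a)
      have h₂ := congrArg (fun X => intch₃ k A B (swapRight k A X ⊗ₜ swapRight k B N)) (hθ a)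
      have h₃ := congrArg (fun X => intch₃ k A B
        (swapLeft k A (swapRight k A X) ⊗ₜ swapLeft k B (swapRight k B N))) (hθ a)
      simp only [map_add, map_sub, map_smul, TensorProduct.sub_tmul,
        swapLeft_intch₃, swapLeft_swapLeft, hN] at h₁ h₂ h₃ ⊢
      exact coLie_combination h₁ h₂ h₃
  · induction q using TensorProduct.induction_on with
    | zero => simp
    | add x y hx hy =>
      simp only [map_add, hx, hy]
      abel
    | tmul a b =>
      rw [map_twistedCo_idm_twistedCo hνp, unassoc_map_idm_twistedCo_twistedCo hνp,
        unassoc_map_idm_twistedCo_twistedCo hνp]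
      have hN : swapLeft k B (TensorProduct.map ν (idm k B) (ν b))
          = TensorProduct.map ν (idm k B) (ν b) := (hνp b).2.symm
      set N := TensorProduct.map ν (idm k B) (ν b)
      have h₁ := congrArg (fun X => intch₃ k A B (X ⊗ₜ N)) (hPPco1 a)
      have h₂ := congrArg (fun X => intch₃ k A B (swapRight k A X ⊗ₜ swapRight k B N)) (hPPco1 a)
      have h₃ := congrArg (fun X => intch₃ k A B
        (swapLeft k A (swapRight k A X) ⊗ₜ swapLeft k B (swapRight k B N))) (hPPco2 a)
      simp only [map_add, map_sub, map_smul, TensorProduct.add_tmul, TensorProduct.sub_tmul,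
        swapLeft_intch₃, swapLeft_swapLeft, hN] at h₁ h₂ h₃ ⊢
      exact coLeibniz_combination h₁ h₂ h₃
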